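/- Let r ≥ 4, m, ℓ be integers. If either (m ≥ r+2 and ℓ ≥ 2) or (m ≥ r+1 and ℓ ≥ 3), then R_r(m;ℓ) > bt_{r−4}(4). -/

import Mathlib

/-- The coloring `φ` of the `r`-element subsets of `[n]` admits a monochromatic
set `Y` of size `m`: all `r`-element subsets of `Y` get the same color. -/
def HasMonoClique (n r m ℓ : ℕ) (φ : Finset ℕ → Fin ℓ) : Prop :=
  ∃ Y : Finset ℕ, Y ⊆ Finset.range n ∧ Y.card = m ∧
    ∃ c : Fin ℓ, ∀ P ⊆ Y, P.card = r → φ P = c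

/-- `R_r(m;ℓ)`: the classical hypergraph Ramsey number. -/
noncomputable def ramsey (r m ℓ : ℕ) : ℕ :=
  sInf {n | ∀ φ : Finset ℕ → Fin ℓ, HasMonoClique n r m ℓ φ}

/-- The binomial tower function: `bt_0(x) = x`, `bt_{i+1}(x) = C(bt_i(x), ⌊bt_i(x)/2⌋)`. -/
def bt : ℕ → ℕ → ℕ
  | 0, x => x
  | i + 1, x => Nat.choose (bt i x) (bt i x / 2)

/-! ### The finite Ramsey theorem for hypergraphs -/

theorem aux_ramsey_exists (ℓ r : ℕ) : ∀ m : ℕ, ∃ n : ℕ, ∀ φ : Finset ℕ → Fin ℓ,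
    ∀ X : Finset ℕ, n ≤ X.card → ∃ Y ⊆ X, Y.card = m ∧
      ∃ c : Fin ℓ, ∀ P ⊆ Y, P.card = r → φ P = c := by
  induction r with
  | zero =>
    intro m
    refine ⟨m, fun φ X hX => ?_⟩
    obtain ⟨Y, hY, hc⟩ := Finset.exists_subset_card_eq hX
    refine ⟨Y, hY, hc, φ ∅, fun P _ hP => ?_⟩
    rw [Finset.card_eq_zero.mp hP]
  | succ r ih =>
    have key : ∀ t : ℕ, ∃ n : ℕ, ∀ φ : Finset ℕ → Fin ℓ, ∀ X : Finset ℕ, n ≤ X.card →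
        ∃ Y ⊆ X, Y.card = t ∧ ∃ χ : ℕ → Fin ℓ, ∀ P ⊆ Y, P.card = r + 1 →
          ∀ a ∈ P, (∀ b ∈ P, a ≤ b) → φ P = χ a := by
      intro t
      induction t with
      | zero =>
        refine ⟨0, fun φ X _ => ⟨∅, by simp, by simp, fun _ => φ ∅, ?_⟩⟩
        intro P hP hc
        rw [Finset.subset_empty.mp hP] at hc
        simp at hc
      | succ t iht =>
        obtain ⟨n, hn⟩ := iht
        obtain ⟨N, hN⟩ := ih n
        refine ⟨N + 1, fun φ X hX => ?_⟩
        have hne : X.Nonempty := by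
          rw [← Finset.card_pos]; omega
        set a := X.min' hne with ha
        have haX : a ∈ X := Finset.min'_mem X hne
        obtain ⟨Y', hY', hcY', c, hc⟩ := hN (fun P => φ (insert a P)) (X.erase a)
          (by rw [Finset.card_erase_of_mem haX]; omega)
        obtain ⟨Z, hZ, hcZ, χ, hχ⟩ := hn φ Y' hcY'.ge
        have hZX : Z ⊆ X.erase a := hZ.trans hY'
        have haZ : a ∉ Z := fun h => by simpa using hZX h
        refine ⟨insert a Z, ?_, ?_, Function.update χ a c, ?_⟩
        · exact Finset.insert_subset haX (hZX.trans (Finset.erase_subset _ _))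
        · rw [Finset.card_insert_of_notMem haZ, hcZ]
        · intro P hP hPc b hb hmin
          by_cases haP : a ∈ P
          · have hab : a ≤ b := by
              rcases Finset.mem_insert.mp (hP hb) with h | h
              · exact h.ge
              · exact Finset.min'_le X b (Finset.mem_of_mem_erase (hZX h))
            have hba : b = a := le_antisymm (hmin a haP) hab
            rw [hba, Function.update_self]
            have := hc (P.erase a) ?_ ?_
            · simpa [Finset.insert_erase haP] using this
            · intro x hx
              rcases Finset.mem_insert.mp (hP (Finset.mem_of_mem_erase hx)) with h | h
              · exact absurd h (Finset.ne_of_mem_erase hx)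
              · exact hZ h
            · rw [Finset.card_erase_of_mem haP]; omega
          · have hba : b ≠ a := fun h => haP (h ▸ hb)
            rw [Function.update_of_ne hba]
            refine hχ P ?_ hPc b hb hmin
            intro x hx
            rcases Finset.mem_insert.mp (hP hx) with h | h
            · exact absurd (h ▸ hx) haP
            · exact h
    intro m
    obtain ⟨n, hn⟩ := key (ℓ * m)
    refine ⟨n, fun φ X hX => ?_⟩
    obtain ⟨Y, hY, hcY, χ, hχ⟩ := hn φ X hX
    have hℓ : (Finset.univ : Finset (Fin ℓ)).Nonempty := ⟨φ ∅, Finset.mem_univ _⟩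
    obtain ⟨c, -, hc⟩ := Finset.exists_le_card_fiber_of_mul_le_card_of_maps_to
      (s := Y) (t := Finset.univ) (f := χ) (n := m) (fun _ _ => Finset.mem_univ _) hℓ
      (by simp [hcY])
    obtain ⟨Z, hZ, hcZ⟩ := Finset.exists_subset_card_eq hc
    refine ⟨Z, (hZ.trans (Finset.filter_subset _ _)).trans hY, hcZ, c, fun P hP hPc => ?_⟩
    have hPne : P.Nonempty := by rw [← Finset.card_pos]; omega
    have hm := Finset.min'_mem P hPne
    rw [hχ P (hP.trans (hZ.trans (Finset.filter_subset _ _))) hPc _ hm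
      (fun b hb => Finset.min'_le P b hb)]
    exact (Finset.mem_filter.mp (hZ (hP hm))).2

/-! ### Colorings of iterated shift graphs -/

theorem aux_antichain (k : ℕ) : ∃ A : ℕ → Finset ℕ, ∀ a < k.choose (k / 2),
    ∀ b < k.choose (k / 2), A a ⊆ Finset.range k ∧ (a ≠ b → ∃ e ∈ A a, e ∉ A b) := by
  set S := Finset.powersetCard (k / 2) (Finset.range k) with hS
  have hcard : S.card = k.choose (k / 2) := by simp [hS]
  let e := S.equivFinOfCardEq hcard
  refine ⟨fun a => if h : a < k.choose (k / 2) then (e.symm ⟨a, h⟩ : Finset ℕ) else ∅, ?_⟩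
  intro a ha b hb
  simp only [ha, hb, dif_pos]
  have h1 := Finset.mem_powersetCard.mp (e.symm ⟨a, ha⟩).2
  have h2 := Finset.mem_powersetCard.mp (e.symm ⟨b, hb⟩).2
  refine ⟨h1.1, fun hab => ?_⟩
  by_contra hcon
  push Not at hcon
  have : (e.symm ⟨a, ha⟩ : Finset ℕ) = e.symm ⟨b, hb⟩ :=
    Finset.eq_of_subset_of_card_le hcon (by rw [h1.2, h2.2])
  have := e.symm.injective (Subtype.ext this)
  exact hab (by simpa using this)

theorem aux_arc (k : ℕ) : ∃ (A : ℕ → Finset ℕ) (g : ℕ → ℕ → ℕ), ∀ a < k.choose (k / 2),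
    ∀ b < k.choose (k / 2), a ≠ b → g a b < k ∧ g a b ∈ A a ∧ g a b ∉ A b := by
  obtain ⟨A, hA⟩ := aux_antichain k
  have : ∀ a b, ∃ e, a < k.choose (k / 2) → b < k.choose (k / 2) → a ≠ b →
      e < k ∧ e ∈ A a ∧ e ∉ A b := by
    intro a b
    by_cases h : a < k.choose (k / 2) ∧ b < k.choose (k / 2) ∧ a ≠ b
    · obtain ⟨h1, h2, h3⟩ := h
      obtain ⟨hs, hd⟩ := hA a h1 b h2
      obtain ⟨e, he, he'⟩ := hd h3
      exact ⟨e, fun _ _ _ => ⟨Finset.mem_range.mp (hs he), he, he'⟩⟩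
    · exact ⟨0, fun h1 h2 h3 => absurd ⟨h1, h2, h3⟩ h⟩
  choose g hg using this
  exact ⟨A, g, fun a ha b hb hab => hg a b ha hb hab⟩

/-- For each level `j ≤ K` a proper coloring of the shift graph on increasing `(j+1)`-tuples. -/
theorem aux_col (K j : ℕ) (hj : j ≤ K) : ∃ c : (ℕ → ℕ) → ℕ,
    (∀ x y : ℕ → ℕ, (∀ i ≤ j, x i = y i) → c x = c y) ∧
    (∀ x : ℕ → ℕ, (∀ i ≤ j, x i < bt K 4) → (∀ i < j, x i < x (i + 1)) → c x < bt (K - j) 4) ∧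
    (∀ x : ℕ → ℕ, (∀ i ≤ j + 1, x i < bt K 4) → (∀ i ≤ j, x i < x (i + 1)) →
      c x ≠ c (fun i => x (i + 1))) := by
  induction j with
  | zero =>
    refine ⟨fun x => x 0, fun x y h => h 0 le_rfl, fun x h _ => h 0 le_rfl, fun x _ h => ?_⟩
    exact (h 0 le_rfl).ne
  | succ j ih =>
    obtain ⟨c, h1, h2, h3⟩ := ih (by omega)
    obtain ⟨A, g, hg⟩ := aux_arc (bt (K - (j + 1)) 4)
    have hK : bt (K - j) 4
        = (bt (K - (j + 1)) 4).choose (bt (K - (j + 1)) 4 / 2) := by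
      rw [show K - j = (K - (j + 1)) + 1 by omega]; rfl
    rw [← hK] at hg
    have G : ∀ x : ℕ → ℕ, (∀ i ≤ j + 1, x i < bt K 4) → (∀ i < j + 1, x i < x (i + 1)) →
        g (c x) (c fun i => x (i + 1)) < bt (K - (j + 1)) 4 ∧
        g (c x) (c fun i => x (i + 1)) ∈ A (c x) ∧
        g (c x) (c fun i => x (i + 1)) ∉ A (c fun i => x (i + 1)) := by
      intro x hx hm
      refine hg _ (h2 x ?_ ?_) _ (h2 _ ?_ ?_) (h3 x hx ?_)
      · exact fun i hi => hx i (by omega)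
      · exact fun i hi => hm i (by omega)
      · exact fun i hi => hx (i + 1) (by omega)
      · exact fun i hi => hm (i + 1) (by omega)
      · exact fun i hi => hm i (by omega)
    refine ⟨fun x => g (c x) (c fun i => x (i + 1)), ?_, ?_, ?_⟩
    · intro x y hxy
      have e1 := h1 x y (fun i hi => hxy i (by omega))
      have e2 := h1 (fun i => x (i + 1)) (fun i => y (i + 1)) (fun i hi => hxy (i + 1) (by omega))
      simp only [e1, e2]
    · exact fun x hx hm => (G x hx hm).1
    · intro x hx hm heq
      have a1 := (G x (fun i hi => hx i (by omega)) (fun i hi => hm i (by omega))).2.2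
      have a2 := (G (fun i => x (i + 1)) (fun i hi => hx (i + 1) (by omega))
        (fun i hi => hm (i + 1) (by omega))).2.1
      simp only at heq
      rw [heq] at a1
      exact a1 a2

/-- The increasing enumeration of a finite set, extended by `0`. -/
noncomputable def auxSeq (P : Finset ℕ) (i : ℕ) : ℕ :=
  if h : i < P.card then P.orderEmbOfFin rfl ⟨i, h⟩ else 0

theorem auxSeq_mem (P : Finset ℕ) (i : ℕ) (h : i < P.card) : auxSeq P i ∈ P := by
  rw [auxSeq, dif_pos h]; exact Finset.orderEmbOfFin_mem _ _ _

theorem auxSeq_lt (P : Finset ℕ) (i j : ℕ) (hij : i < j) (h : j < P.card) :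
    auxSeq P i < auxSeq P j := by
  rw [auxSeq, auxSeq, dif_pos h, dif_pos (hij.trans h)]
  exact (P.orderEmbOfFin rfl).strictMono hij

theorem auxSeq_window (Y : Finset ℕ) (t r : ℕ) (h : t + r ≤ Y.card) :
    ∃ P ⊆ Y, P.card = r ∧ ∀ i < r, auxSeq P i = auxSeq Y (t + i) := by
  have hmono : StrictMono (fun i : Fin r => auxSeq Y (t + i)) := by
    intro i j hij
    exact auxSeq_lt Y _ _ (by have : (i : ℕ) < j := hij
                              omega) (by have := j.2
                                         omega)
  refine ⟨Finset.univ.image (fun i : Fin r => auxSeq Y (t + i)), ?_, ?_, ?_⟩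
  · intro x hx
    obtain ⟨i, -, rfl⟩ := Finset.mem_image.mp hx
    exact auxSeq_mem Y _ (by have := i.2
                             omega)
  · rw [Finset.card_image_of_injective _ hmono.injective]; simp
  · intro i hi
    set P := Finset.univ.image (fun i : Fin r => auxSeq Y (t + i)) with hP
    have hc : P.card = r := by
      rw [hP, Finset.card_image_of_injective _ hmono.injective]; simp
    have hu := Finset.orderEmbOfFin_unique hc (f := fun i : Fin r => auxSeq Y (t + i))
      (fun i => Finset.mem_image_of_mem _ (Finset.mem_univ i)) hmono
    rw [auxSeq, dif_pos (by omega)]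
    have := congrFun hu ⟨i, hi⟩
    simp only at this
    rw [this]
    exact Finset.orderEmbOfFin_eq_orderEmbOfFin_iff.mpr rfl

theorem aux_walk (r : ℕ) (hr : 4 ≤ r) : ∃ C : Finset ℕ → ℕ → ℕ, ∀ (d : ℕ) (Y : Finset ℕ),
    Y ⊆ Finset.range (bt (r - 4) 4) → Y.card = r + d → ∃ w : ℕ → ℕ,
      (∀ t ≤ d + 3, w t < 4) ∧ (∀ t < d + 3, w t ≠ w (t + 1)) ∧
      ∀ t ≤ d, ∃ P ⊆ Y, P.card = r ∧ ∀ i ≤ 3, C P i = w (t + i) := by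
  obtain ⟨c, h1, h2, h3⟩ := aux_col (r - 4) (r - 4) le_rfl
  refine ⟨fun P i => c (fun j => auxSeq P (i + j)), fun d Y hY hc => ?_⟩
  have hb : ∀ i < r + d, auxSeq Y i < bt (r - 4) 4 := fun i hi =>
    Finset.mem_range.mp (hY (auxSeq_mem Y i (by omega)))
  refine ⟨fun t => c (fun j => auxSeq Y (t + j)), ?_, ?_, ?_⟩
  · intro t ht
    have := h2 (fun j => auxSeq Y (t + j)) (fun i hi => hb _ (by omega))
      (fun i hi => auxSeq_lt Y _ _ (by omega) (by omega))
    simpa [bt] using this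
  · intro t ht
    have := h3 (fun j => auxSeq Y (t + j)) (fun i hi => hb _ (by omega))
      (fun i hi => auxSeq_lt Y _ _ (by omega) (by omega))
    intro heq
    apply this
    simp only at heq
    rw [heq]
    congr 1
    funext j
    congr 1
    omega
  · intro t ht
    obtain ⟨P, hP, hPc, hs⟩ := auxSeq_window Y t r (by omega)
    refine ⟨P, hP, hPc, fun i hi => h1 _ _ fun j hj => ?_⟩
    rw [hs _ (by omega)]
    congr 1
    omega

/-! ### Two finite colorings of short walks in the complete graph on four vertices -/

/-- A proper 3-coloring of three-vertex walks, packed into a base-4 table. -/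
def auxT (a b c : ℕ) : ℕ := 385899780285031660710628017127849984 / 4 ^ (a + 4 * b + 16 * c) % 4

/-- A 2-coloring of four-vertex walks, packed into a binary table. -/
def auxB (a b c d : ℕ) : ℕ :=
  4099070347597491303575279443681665276854676713371584826679967822643200 / 2 ^ (a + 4 * b + 16 * c + 64 * d) % 2

theorem auxT_fin : ∀ a b c d : Fin 4, a ≠ b → b ≠ c → c ≠ d →
    auxT a b c < 3 ∧ auxT a b c ≠ auxT b c d := by
  decide +kernel

set_option synthInstance.maxHeartbeats 400000 in
set_option synthInstance.maxSize 4000 in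
theorem auxB_fin : ∀ a b c d e f : Fin 4, a ≠ b → b ≠ c → c ≠ d → d ≠ e → e ≠ f →
    ¬ (auxB a b c d = auxB b c d e ∧ auxB b c d e = auxB c d e f) := by
  decide +kernel

theorem auxT_spec (a : ℕ) (ha : a < 4) (b : ℕ) (hb : b < 4) (hab : a ≠ b)
    (c : ℕ) (hc : c < 4) (hbc : b ≠ c) (d : ℕ) (hd : d < 4) (hcd : c ≠ d) :
    auxT a b c < 3 ∧ auxT a b c ≠ auxT b c d :=
  auxT_fin ⟨a, ha⟩ ⟨b, hb⟩ ⟨c, hc⟩ ⟨d, hd⟩ (by simpa using hab) (by simpa using hbc)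
    (by simpa using hcd)

theorem auxB_spec (a : ℕ) (ha : a < 4) (b : ℕ) (hb : b < 4) (hab : a ≠ b)
    (c : ℕ) (hc : c < 4) (hbc : b ≠ c) (d : ℕ) (hd : d < 4) (hcd : c ≠ d)
    (e : ℕ) (he : e < 4) (hde : d ≠ e) (f : ℕ) (hf : f < 4) (hef : e ≠ f) :
    ¬ (auxB a b c d = auxB b c d e ∧ auxB b c d e = auxB c d e f) :=
  auxB_fin ⟨a, ha⟩ ⟨b, hb⟩ ⟨c, hc⟩ ⟨d, hd⟩ ⟨e, he⟩ ⟨f, hf⟩ (by simpa using hab)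
    (by simpa using hbc) (by simpa using hcd) (by simpa using hde) (by simpa using hef)

theorem aux_lower (r m ℓ : ℕ) (hr : 4 ≤ r)
    (h : (r + 2 ≤ m ∧ 2 ≤ ℓ) ∨ (r + 1 ≤ m ∧ 3 ≤ ℓ)) :
    ∃ φ : Finset ℕ → Fin ℓ, ¬ HasMonoClique (bt (r - 4) 4) r m ℓ φ := by
  obtain ⟨C, hC⟩ := aux_walk r hr
  rcases h with ⟨hm, hℓ⟩ | ⟨hm, hℓ⟩
  · refine ⟨fun P => ⟨auxB (C P 0) (C P 1) (C P 2) (C P 3),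
      lt_of_lt_of_le (Nat.mod_lt _ (by norm_num)) hℓ⟩, ?_⟩
    rintro ⟨Y, hY, hYc, c, hc⟩
    obtain ⟨Z, hZ, hZc⟩ := Finset.exists_subset_card_eq (s := Y) (n := r + 2) (by omega)
    obtain ⟨w, hw, hne, hP⟩ := hC 2 Z (hZ.trans hY) hZc
    have key : ∀ t ≤ 2, auxB (w t) (w (t + 1)) (w (t + 2)) (w (t + 3)) = c := by
      intro t ht
      obtain ⟨P, hPZ, hPc, hi⟩ := hP t ht
      have := congrArg Fin.val (hc P (hPZ.trans hZ) hPc)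
      simp only at this
      rw [hi 0 (by omega), hi 1 (by omega), hi 2 (by omega), hi 3 (by omega)] at this
      simpa using this
    have k0 := key 0 (by omega)
    have k1 := key 1 (by omega)
    have k2 := key 2 (by omega)
    exact auxB_spec (w 0) (hw 0 (by omega)) (w 1) (hw 1 (by omega)) (hne 0 (by omega))
      (w 2) (hw 2 (by omega)) (hne 1 (by omega)) (w 3) (hw 3 (by omega)) (hne 2 (by omega))
      (w 4) (hw 4 (by omega)) (hne 3 (by omega)) (w 5) (hw 5 (by omega)) (hne 4 (by omega))
      ⟨k0.trans k1.symm, k1.trans k2.symm⟩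
  · refine ⟨fun P => ⟨auxT (C P 0) (C P 1) (C P 2) % 3,
      lt_of_lt_of_le (Nat.mod_lt _ (by norm_num)) hℓ⟩, ?_⟩
    rintro ⟨Y, hY, hYc, c, hc⟩
    obtain ⟨Z, hZ, hZc⟩ := Finset.exists_subset_card_eq (s := Y) (n := r + 1) (by omega)
    obtain ⟨w, hw, hne, hP⟩ := hC 1 Z (hZ.trans hY) hZc
    have key : ∀ t ≤ 1, auxT (w t) (w (t + 1)) (w (t + 2)) % 3 = c := by
      intro t ht
      obtain ⟨P, hPZ, hPc, hi⟩ := hP t ht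
      have := congrArg Fin.val (hc P (hPZ.trans hZ) hPc)
      simp only at this
      rw [hi 0 (by omega), hi 1 (by omega), hi 2 (by omega)] at this
      simpa using this
    have k0 := key 0 (by omega)
    have k1 := key 1 (by omega)
    simp only [Nat.zero_add, Nat.reduceAdd] at k0 k1
    have s0 := auxT_spec (w 0) (hw 0 (by omega)) (w 1) (hw 1 (by omega)) (hne 0 (by omega))
      (w 2) (hw 2 (by omega)) (hne 1 (by omega)) (w 3) (hw 3 (by omega)) (hne 2 (by omega))
    have s1 := auxT_spec (w 1) (hw 1 (by omega)) (w 2) (hw 2 (by omega)) (hne 1 (by omega))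
      (w 3) (hw 3 (by omega)) (hne 2 (by omega)) (w 4) (hw 4 (by omega)) (hne 3 (by omega))
    rw [Nat.mod_eq_of_lt s0.1] at k0
    rw [Nat.mod_eq_of_lt s1.1] at k1
    exact s0.2 (k0.trans k1.symm)

/-- If `r ≥ 4` and either (`m ≥ r+2` and `ℓ ≥ 2`) or (`m ≥ r+1` and `ℓ ≥ 3`),
then `R_r(m;ℓ) > bt_{r-4}(4)`. -/
theorem ramsey_gt_binomialTower (r m ℓ : ℕ) (hr : 4 ≤ r)
    (h : (r + 2 ≤ m ∧ 2 ≤ ℓ) ∨ (r + 1 ≤ m ∧ 3 ≤ ℓ)) :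
    bt (r - 4) 4 < ramsey r m ℓ := by
  have hne : {n | ∀ φ : Finset ℕ → Fin ℓ, HasMonoClique n r m ℓ φ}.Nonempty := by
    obtain ⟨n, hn⟩ := aux_ramsey_exists ℓ r m
    exact ⟨n, fun φ => hn φ (Finset.range n) (by simp)⟩
  have hmem := Nat.sInf_mem hne
  obtain ⟨φ, hφ⟩ := aux_lower r m ℓ hr h
  by_contra hlt
  push Not at hlt
  obtain ⟨Y, hY, hrest⟩ := hmem φ
  refine hφ ⟨Y, hY.trans ?_, hrest⟩
  intro x hx
  exact Finset.mem_range.mpr (lt_of_lt_of_le (Finset.mem_range.mp hx) hlt)
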